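/- Directly-follows completeness transfers through the named-subtree operator: let f ∈ 𝔸, let P be a plain process tree (containing no ▽ and no △ nodes) whose alphabet Σ(P) does not contain f, and let L be a hierarchical event log with L ⊆ L(▽_f(P)) that is directly-follows complete with respect to L(▽_f(P)). Then the projection L|₁ satisfies L|₁ ⊆ L(P) and L|₁ is directly-follows complete with respect to L(P). -/

import Mathlib

/-- Symbols: activities `a ∈ 𝔸` and recursion markers `△_f`. -/
inductive HSym (A : Type*) where
  | act : A → HSym A
  | mark : A → HSym A

/-- An event is a finite sequence of symbols. -/
abbrev Event (A : Type*) := List (HSym A)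

/-- A hierarchical trace is a finite sequence of events. -/
abbrev HTrace (A : Type*) := List (Event A)

/-- Hierarchy concatenation `s.t`: prefix the symbol `s` to every event of the trace `t`
(for the empty trace it yields the single event `⟨s⟩`). -/
def hcat {A : Type*} (s : HSym A) : HTrace A → HTrace A
  | [] => [[s]]
  | t => t.map (s :: ·)

/-- Interleaving (shuffle) of two sequences. -/
inductive Interleaving {α : Type*} : List α → List α → List α → Prop
  | nil : Interleaving [] [] []
  | left {a t₁ t₂ t} : Interleaving t₁ t₂ t → Interleaving (a :: t₁) t₂ (a :: t)
  | right {a t₁ t₂ t} : Interleaving t₁ t₂ t → Interleaving t₁ (a :: t₂) (a :: t)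

/-- Sequence join. -/
def seqJoin {α : Type*} : List (Set (List α)) → Set (List α)
  | [] => {[]}
  | L :: Ls => {t | ∃ t₁ ∈ L, ∃ t₂ ∈ seqJoin Ls, t = t₁ ++ t₂}

/-- Exclusive-choice join. -/
def choiceJoin {α : Type*} (Ls : List (Set (List α))) : Set (List α) :=
  {t | ∃ L ∈ Ls, t ∈ L}

/-- Members of the loop language. -/
inductive LoopMem {α : Type*} (body redo : Set (List α)) : List α → Prop
  | single {t} : t ∈ body → LoopMem body redo t
  | cons {t t' r} : t ∈ body → t' ∈ redo → LoopMem body redo r →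
      LoopMem body redo (t ++ t' ++ r)

/-- Structured-loop join. -/
def loopJoin {α : Type*} : List (Set (List α)) → Set (List α)
  | [] => ∅
  | L :: Ls => {t | LoopMem L (choiceJoin Ls) t}

/-- Parallel join. -/
def parJoin {α : Type*} : List (Set (List α)) → Set (List α)
  | [] => {[]}
  | L :: Ls => {t | ∃ t₁ ∈ L, ∃ t₂ ∈ parJoin Ls, Interleaving t₁ t₂ t}

/-- Hierarchical process trees: process trees extended with the named-subtree
operator `▽_f` and the recursion leaf `△_f`. -/
inductive HTree (A : Type*) where
  | act : A → HTree A
  | tau : HTree A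
  | seq : List (HTree A) → HTree A
  | choice : List (HTree A) → HTree A
  | loop : List (HTree A) → HTree A
  | par : List (HTree A) → HTree A
  | named : A → HTree A → HTree A
  | recCall : A → HTree A

universe u

mutual
/-- `▽ˡ_f(M)`: the least hierarchical language satisfying
`▽ˡ_f(M) = { f.(t′₁ ⋯ t′ₙ) | ⟨x₁,…,xₙ⟩ ∈ M, t′ᵢ ∈ ψ_f(xᵢ) }`. -/
inductive NamedLang {A : Type u} (f : A) (M : Set (HTrace A)) : HTrace A → Prop
  | mk (xs : HTrace A) (ts : List (HTrace A)) :
      xs ∈ M → ts.length = xs.length →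
      (∀ i, Psi f M (xs.getD i []) (ts.getD i [])) →
      NamedLang f M (hcat (HSym.act f) ts.flatten)

/-- `ψ_f`: maps an event to the set of traces resolving the recursion markers `△_f`. -/
inductive Psi {A : Type u} (f : A) (M : Set (HTrace A)) : Event A → HTrace A → Prop
  | nil : Psi f M [] []
  | recSame {t : HTrace A} : NamedLang f M t → Psi f M [HSym.mark f] t
  | recOther {g : A} : g ≠ f → Psi f M [HSym.mark g] [[HSym.mark g]]
  | act {a : A} {x : Event A} {t : HTrace A} :
      Psi f M x t → Psi f M (HSym.act a :: x) (hcat (HSym.act a) t)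
end

/-- The hierarchical language of a hierarchical process tree. -/
def hlang {A : Type*} : HTree A → Set (HTrace A)
  | .act a => {[[HSym.act a]]}
  | .tau => {[]}
  | .recCall f => {[[HSym.mark f]]}
  | .seq Ps => seqJoin (Ps.attach.map fun p => hlang p.1)
  | .choice Ps => choiceJoin (Ps.attach.map fun p => hlang p.1)
  | .loop Ps => loopJoin (Ps.attach.map fun p => hlang p.1)
  | .par Ps => parJoin (Ps.attach.map fun p => hlang p.1)
  | .named f P => {t | NamedLang f (hlang P) t}
termination_by P => sizeOf P
decreasing_by
  all_goals first
    | (have := List.sizeOf_lt_of_mem p.2; simp; omega)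
    | simp

/-- Plain process trees: no named subtrees `▽` and no recursion leaves `△`. -/
inductive IsPlain {A : Type*} : HTree A → Prop
  | act (a : A) : IsPlain (HTree.act a)
  | tau : IsPlain HTree.tau
  | seq {Ps : List (HTree A)} : (∀ P ∈ Ps, IsPlain P) → IsPlain (HTree.seq Ps)
  | choice {Ps : List (HTree A)} : (∀ P ∈ Ps, IsPlain P) → IsPlain (HTree.choice Ps)
  | loop {Ps : List (HTree A)} : (∀ P ∈ Ps, IsPlain P) → IsPlain (HTree.loop Ps)
  | par {Ps : List (HTree A)} : (∀ P ∈ Ps, IsPlain P) → IsPlain (HTree.par Ps)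


/-- Projection of a hierarchical trace: remove the first symbol of every event
and discard events that thereby become empty. -/
def projTrace {A : Type*} (t : HTrace A) : HTrace A :=
  (t.map List.tail).filter (fun x => !x.isEmpty)

/-- Projection of a hierarchical event log. -/
def projLog {A : Type*} (L : Set (HTrace A)) : Set (HTrace A) :=
  projTrace '' L

/-- The set of activities occurring as leaves of a hierarchical process tree. -/
def treeActs {A : Type*} : HTree A → Set A
  | .act a => {a}
  | .tau => ∅
  | .seq Ps => {a | ∃ p ∈ Ps.attach, a ∈ treeActs p.1}
  | .choice Ps => {a | ∃ p ∈ Ps.attach, a ∈ treeActs p.1}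
  | .loop Ps => {a | ∃ p ∈ Ps.attach, a ∈ treeActs p.1}
  | .par Ps => {a | ∃ p ∈ Ps.attach, a ∈ treeActs p.1}
  | .named f P => {f} ∪ treeActs P
  | .recCall f => {f}
termination_by P => sizeOf P
decreasing_by
  all_goals first
    | (have := List.sizeOf_lt_of_mem p.2; simp; omega)
    | simp

/-- Pairs of events occurring consecutively in some trace of `M`. -/
def DFPairs {A : Type*} (M : Set (HTrace A)) : Set (Event A × Event A) :=
  {p | ∃ t ∈ M, ∃ u v : HTrace A, t = u ++ [p.1, p.2] ++ v}

/-- First events of nonempty traces of `M`. -/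
def Starts {A : Type*} (M : Set (HTrace A)) : Set (Event A) :=
  {x | ∃ t ∈ M, t.head? = some x}

/-- Last events of nonempty traces of `M`. -/
def Ends {A : Type*} (M : Set (HTrace A)) : Set (Event A) :=
  {x | ∃ t ∈ M, t.getLast? = some x}

/-- Symbols occurring in events of `M`. -/
def SymsOf {A : Type*} (M : Set (HTrace A)) : Set (HSym A) :=
  {s | ∃ t ∈ M, ∃ x ∈ t, s ∈ x}

/-- Directly-follows completeness of a log `L` with respect to a language `M`. -/
def DFComplete {A : Type*} (L M : Set (HTrace A)) : Prop :=
  DFPairs M ⊆ DFPairs L ∧ Starts M ⊆ Starts L ∧ Ends M ⊆ Ends L ∧ SymsOf M ⊆ SymsOf L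

section Joins

variable {α : Type*} {p : α → Prop} {Ls : List (Set (List α))}

theorem Interleaving.forall_mem {t₁ t₂ t : List α} (h : Interleaving t₁ t₂ t)
    (h₁ : ∀ x ∈ t₁, p x) (h₂ : ∀ x ∈ t₂, p x) : ∀ x ∈ t, p x := by
  induction h with
  | nil => simp
  | left _ ih => simp_all
  | right _ ih => simp_all

theorem seqJoin_forall_mem (h : ∀ L ∈ Ls, ∀ t ∈ L, ∀ x ∈ t, p x) :
    ∀ t ∈ seqJoin Ls, ∀ x ∈ t, p x := by
  induction Ls with
  | nil => simp [seqJoin]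
  | cons L Ls ih =>
    rintro _ ⟨t₁, h₁, t₂, h₂, rfl⟩ x hx
    rcases List.mem_append.1 hx with hx | hx
    · exact h L (by simp) t₁ h₁ x hx
    · exact ih (fun L' hL' => h L' (by simp [hL'])) t₂ h₂ x hx

theorem choiceJoin_forall_mem (h : ∀ L ∈ Ls, ∀ t ∈ L, ∀ x ∈ t, p x) :
    ∀ t ∈ choiceJoin Ls, ∀ x ∈ t, p x := by
  rintro t ⟨L, hL, ht⟩
  exact h L hL t ht

theorem LoopMem.forall_mem {body redo : Set (List α)} {t : List α} (h : LoopMem body redo t)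
    (hb : ∀ t ∈ body, ∀ x ∈ t, p x) (hr : ∀ t ∈ redo, ∀ x ∈ t, p x) : ∀ x ∈ t, p x := by
  induction h with
  | single ht => exact hb _ ht
  | cons ht ht' _ ih =>
    intro x hx
    rcases List.mem_append.1 hx with hx | hx
    · rcases List.mem_append.1 hx with hx | hx
      · exact hb _ ht x hx
      · exact hr _ ht' x hx
    · exact ih x hx

theorem loopJoin_forall_mem (h : ∀ L ∈ Ls, ∀ t ∈ L, ∀ x ∈ t, p x) :
    ∀ t ∈ loopJoin Ls, ∀ x ∈ t, p x := by
  cases Ls with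
  | nil => simp [loopJoin]
  | cons L Ls =>
    intro t ht
    exact LoopMem.forall_mem ht (h L (by simp))
      (choiceJoin_forall_mem fun L' hL' => h L' (by simp [hL']))

theorem parJoin_forall_mem (h : ∀ L ∈ Ls, ∀ t ∈ L, ∀ x ∈ t, p x) :
    ∀ t ∈ parJoin Ls, ∀ x ∈ t, p x := by
  induction Ls with
  | nil => simp [parJoin]
  | cons L Ls ih =>
    rintro t ⟨t₁, h₁, t₂, h₂, hi⟩
    exact hi.forall_mem (h L (by simp) t₁ h₁)
      (ih (fun L' hL' => h L' (by simp [hL'])) t₂ h₂)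

end Joins

/-- Every event in the language of a plain tree is a single activity of the tree. -/
theorem IsPlain.exists_eq_act {A : Type*} {P : HTree A} (hP : IsPlain P) :
    ∀ t ∈ hlang P, ∀ x ∈ t, ∃ a ∈ treeActs P, x = [HSym.act a] := by
  induction hP with
  | act a => simp [hlang, treeActs]
  | tau => simp [hlang]
  | @seq Ps _ ih =>
    rw [hlang]
    refine seqJoin_forall_mem fun L hL t ht x hx => ?_
    obtain ⟨Q, hQ, rfl⟩ := List.mem_map.1 hL
    obtain ⟨a, ha, rfl⟩ := ih Q.1 Q.2 t ht x hx
    exact ⟨a, by rw [treeActs]; exact ⟨Q, hQ, ha⟩, rfl⟩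
  | @choice Ps _ ih =>
    rw [hlang]
    refine choiceJoin_forall_mem fun L hL t ht x hx => ?_
    obtain ⟨Q, hQ, rfl⟩ := List.mem_map.1 hL
    obtain ⟨a, ha, rfl⟩ := ih Q.1 Q.2 t ht x hx
    exact ⟨a, by rw [treeActs]; exact ⟨Q, hQ, ha⟩, rfl⟩
  | @loop Ps _ ih =>
    rw [hlang]
    refine loopJoin_forall_mem fun L hL t ht x hx => ?_
    obtain ⟨Q, hQ, rfl⟩ := List.mem_map.1 hL
    obtain ⟨a, ha, rfl⟩ := ih Q.1 Q.2 t ht x hx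
    exact ⟨a, by rw [treeActs]; exact ⟨Q, hQ, ha⟩, rfl⟩
  | @par Ps _ ih =>
    rw [hlang]
    refine parJoin_forall_mem fun L hL t ht x hx => ?_
    obtain ⟨Q, hQ, rfl⟩ := List.mem_map.1 hL
    obtain ⟨a, ha, rfl⟩ := ih Q.1 Q.2 t ht x hx
    exact ⟨a, by rw [treeActs]; exact ⟨Q, hQ, ha⟩, rfl⟩

theorem hcat_of_ne_nil {A : Type*} (s : HSym A) {t : HTrace A} (ht : t ≠ []) :
    hcat s t = t.map (s :: ·) := by
  cases t with
  | nil => exact absurd rfl ht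
  | cons => rfl

theorem psi_act_singleton_iff {A : Type*} {f a : A} {M : Set (HTrace A)} {t : HTrace A} :
    Psi f M [HSym.act a] t ↔ t = [[HSym.act a]] := by
  constructor
  · rintro (_ | _ | _ | ⟨⟨⟩⟩)
    rfl
  · rintro rfl
    exact Psi.act Psi.nil

/-- On a language whose events are single activities, `▽ˡ_f` only prefixes `f`. -/
theorem namedLang_iff {A : Type*} {f : A} {M : Set (HTrace A)}
    (hM : ∀ t ∈ M, ∀ x ∈ t, ∃ a, x = [HSym.act a]) {t : HTrace A} :
    NamedLang f M t ↔ ∃ xs ∈ M, t = hcat (HSym.act f) xs := by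
  constructor
  · rintro ⟨xs, ts, hxs, hlen, hpsi⟩
    refine ⟨xs, hxs, ?_⟩
    have hts : ts = xs.map fun x => [x] := by
      refine List.ext_getElem (by simpa using hlen) fun i hi hi' => ?_
      have hix : i < xs.length := hlen ▸ hi
      have h := hpsi i
      rw [List.getD_eq_getElem _ _ hix, List.getD_eq_getElem _ _ hi] at h
      obtain ⟨a, ha⟩ := hM xs hxs _ (List.getElem_mem hix)
      rw [ha, psi_act_singleton_iff] at h
      simp [h, ha]
    rw [hts, ← List.flatMap_def]
    simp
  · rintro ⟨xs, hxs, rfl⟩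
    have hflat : (xs.map fun x => [x]).flatten = xs := by
      rw [← List.flatMap_def]
      simp
    have h := NamedLang.mk (f := f) xs (xs.map fun x => [x]) hxs (by simp) fun i => ?_
    · rwa [hflat] at h
    · by_cases hi : i < xs.length
      · obtain ⟨a, ha⟩ := hM xs hxs _ (List.getElem_mem hi)
        rw [List.getD_eq_getElem _ _ hi, List.getD_eq_getElem _ _ (by simpa using hi),
          List.getElem_map, ha]
        exact psi_act_singleton_iff.2 rfl
      · rw [List.getD_eq_default _ _ (by omega), List.getD_eq_default _ _ (by simp; omega)]
        exact Psi.nil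

theorem projTrace_append {A : Type*} (t₁ t₂ : HTrace A) :
    projTrace (t₁ ++ t₂) = projTrace t₁ ++ projTrace t₂ := by
  simp [projTrace]

theorem projTrace_cons_cons {A : Type*} (s : HSym A) {x : Event A} (hx : x ≠ []) (t : HTrace A) :
    projTrace ((s :: x) :: t) = x :: projTrace t := by
  simp [projTrace, hx]

theorem projTrace_hcat {A : Type*} (s : HSym A) {t : HTrace A} (ht : ∀ x ∈ t, x ≠ []) :
    projTrace (hcat s t) = t := by
  cases t with
  | nil => rfl
  | cons x t =>
    rw [hcat_of_ne_nil s (by simp), projTrace, List.map_map, List.filter_eq_self.2]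
    · simp [Function.comp_def]
    · simpa [Function.comp_def] using ht

theorem mem_event_of_mem_hcat {A : Type*} {s s' : HSym A} {t : HTrace A} {e : Event A}
    (he : e ∈ hcat s t) (hs' : s' ∈ e) (hne : s' ≠ s) : ∃ x ∈ t, s' ∈ x := by
  cases t with
  | nil => simp_all [hcat]
  | cons y t =>
    rw [hcat_of_ne_nil s (by simp)] at he
    obtain ⟨x, hx, rfl⟩ := List.mem_map.1 he
    exact ⟨x, hx, by simpa [hne] using hs'⟩

/-- directly-follows completeness transfers through the named-subtree
operator. -/
theorem df_completeness_transfers {A : Type*} (f : A) (P : HTree A) (hP : IsPlain P)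
    (hf : f ∉ treeActs P) (L : Set (HTrace A))
    (hsub : L ⊆ hlang (HTree.named f P))
    (hdf : DFComplete L (hlang (HTree.named f P))) :
    projLog L ⊆ hlang P ∧ DFComplete (projLog L) (hlang P) := by
  have hact := hP.exists_eq_act
  have hne : ∀ t ∈ hlang P, ∀ x ∈ t, x ≠ [] := by
    intro t ht x hx
    obtain ⟨a, -, rfl⟩ := hact t ht x hx
    simp
  have hnamed : ∀ t, t ∈ hlang (HTree.named f P) ↔ ∃ xs ∈ hlang P, t = hcat (HSym.act f) xs := by
    intro t
    rw [hlang]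
    exact namedLang_iff fun t ht x hx => (hact t ht x hx).imp fun _ h => h.2
  have hmem : ∀ t ∈ hlang P, t ≠ [] → t.map (HSym.act f :: ·) ∈ hlang (HTree.named f P) :=
    fun t ht h => (hnamed _).2 ⟨t, ht, (hcat_of_ne_nil _ h).symm⟩
  obtain ⟨hpairs, hstarts, hends, hsyms⟩ := hdf
  refine ⟨?_, ?_, ?_, ?_, ?_⟩
  · rintro _ ⟨l, hl, rfl⟩
    obtain ⟨t, ht, rfl⟩ := (hnamed l).1 (hsub hl)
    rwa [projTrace_hcat _ (hne t ht)]
  · rintro ⟨x, y⟩ ⟨t, ht, u, v, rfl⟩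
    obtain ⟨l, hl, u', v', rfl⟩ := @hpairs (HSym.act f :: x, HSym.act f :: y)
      ⟨_, hmem _ ht (by simp), u.map (HSym.act f :: ·), v.map (HSym.act f :: ·), by simp⟩
    refine ⟨_, ⟨_, hl, rfl⟩, projTrace u', projTrace v', ?_⟩
    simp only [projTrace_append, projTrace_cons_cons _ (hne _ ht x (by simp)),
      projTrace_cons_cons _ (hne _ ht y (by simp))]
    rfl
  · rintro x ⟨t, ht, hx⟩
    obtain ⟨r, rfl⟩ := List.head?_eq_some_iff.1 hx
    obtain ⟨l, hl, hl'⟩ := @hstarts (HSym.act f :: x) ⟨_, hmem _ ht (by simp), by simp⟩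
    obtain ⟨r', rfl⟩ := List.head?_eq_some_iff.1 hl'
    exact ⟨_, ⟨_, hl, rfl⟩, by rw [projTrace_cons_cons _ (hne _ ht x (by simp))]; rfl⟩
  · rintro x ⟨t, ht, hx⟩
    obtain ⟨r, rfl⟩ := List.getLast?_eq_some_iff.1 hx
    obtain ⟨l, hl, hl'⟩ := @hends (HSym.act f :: x) ⟨_, hmem _ ht (by simp), by simp⟩
    obtain ⟨r', rfl⟩ := List.getLast?_eq_some_iff.1 hl'
    refine ⟨_, ⟨_, hl, rfl⟩, ?_⟩
    rw [projTrace_append, projTrace_cons_cons _ (hne _ ht x (by simp))]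
    simp [projTrace]
  · rintro s ⟨t, ht, x, hx, hs⟩
    have hsf : s ≠ HSym.act f := by
      obtain ⟨a, ha, rfl⟩ := hact t ht x hx
      rintro rfl
      obtain rfl : f = a := by simpa using hs
      exact hf ha
    obtain ⟨l, hl, e, he, hse⟩ := hsyms ⟨_, hmem t ht (List.ne_nil_of_mem hx),
      _, List.mem_map_of_mem hx, List.mem_cons_of_mem _ hs⟩
    obtain ⟨t', ht', rfl⟩ := (hnamed l).1 (hsub hl)
    refine ⟨_, ⟨_, hl, rfl⟩, ?_⟩
    rw [projTrace_hcat _ (hne t' ht')]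
    exact mem_event_of_mem_hcat he hse hsf
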